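/- If an outcome a : N → M of a singleton congestion game is evenly distributed (|n_x(a) − n_y(a)| ≤ 1 for all resources x, y ∈ M), then a minimizes the total cost c̄(a) = ∑_{i∈N} f(n_{a(i)}(a)) over all outcomes a' : N → M. -/

import Mathlib

/-- The load of resource `x` under outcome `a`: the number of players choosing `x`. -/
def load {N M : Type*} [Fintype N] [DecidableEq M] (a : N → M) (x : M) : ℕ :=
  (Finset.univ.filter fun i => a i = x).card

/-- The total cost of an outcome. -/
def totalCost {N M : Type*} [Fintype N] [DecidableEq M] (f : ℕ → ℚ) (a : N → M) : ℚ :=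
  ∑ i, f (load a (a i))

/-- A sequence with nondecreasing increments lies above each line through
two consecutive points of its graph. -/
theorem add_increment_mul_le_of_monotone (g : ℕ → ℚ)
    (hg : Monotone fun k => g (k + 1) - g k) (q k : ℕ) :
    g q + (g (q + 1) - g q) * ((k : ℚ) - q) ≤ g k := by
  rcases le_total q k with h | h
  · induction k, h using Nat.le_induction with
    | base => simp
    | succ k hk ih =>
      have hd : g (q + 1) - g q ≤ g (k + 1) - g k := hg hk
      push_cast
      linarith
  · induction q, h using Nat.le_induction with
    | base => simp
    | succ q hq ih =>
      have hd : g (q + 1) - g q ≤ g (q + 1 + 1) - g (q + 1) := hg q.le_succ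
      have hq' : (k : ℚ) ≤ q := by exact_mod_cast hq
      push_cast
      nlinarith [mul_le_mul_of_nonneg_right hd (by linarith : (0 : ℚ) ≤ q + 1 - k)]

/-- If `f` is nondecreasing with nondecreasing increments, then so are the increments of
`k ↦ k * f k`. -/
theorem monotone_increment_natCast_mul (f : ℕ → ℚ) (hf_mono : ∀ k, f k ≤ f (k + 1))
    (hf_conv : ∀ k, f (k + 1) - f k ≤ f (k + 2) - f (k + 1)) :
    Monotone fun k : ℕ => ((k + 1 : ℕ) : ℚ) * f (k + 1) - (k : ℚ) * f k := by
  refine monotone_nat_of_le_succ fun k => ?_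
  have h := mul_le_mul_of_nonneg_left (hf_conv k) (Nat.cast_nonneg (α := ℚ) k)
  have h' : f (k + 1) ≤ f (k + 2) := hf_mono (k + 1)
  push_cast
  rw [show k + 1 + 1 = k + 2 from rfl]
  linarith

theorem sum_load {N M : Type*} [Fintype N] [Fintype M] [DecidableEq M] (a : N → M) :
    ∑ x, load a x = Fintype.card N :=
  (Finset.card_eq_sum_card_fiberwise fun i _ => Finset.mem_univ (a i)).symm

theorem totalCost_eq_sum_load_mul {N M : Type*} [Fintype N] [Fintype M] [DecidableEq M]
    (f : ℕ → ℚ) (a : N → M) :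
    totalCost f a = ∑ x, (load a x : ℚ) * f (load a x) := by
  rw [totalCost, ← Finset.sum_fiberwise Finset.univ a]
  refine Finset.sum_congr rfl fun x _ => ?_
  rw [Finset.sum_congr rfl fun i hi => by rw [(Finset.mem_filter.mp hi).2],
    Finset.sum_const, nsmul_eq_mul, load]

/-- Any evenly distributed outcome minimizes the total cost. -/
theorem evenlyDistributed_imp_totalCost_optimal
    {N M : Type*} [Fintype N] [Fintype M] [DecidableEq M] [Nonempty N] [Nonempty M]
    (f : ℕ → ℚ)
    (hf_mono : ∀ k, f k < f (k + 1))
    (hf_conv : ∀ k, f (k + 1) - f k ≤ f (k + 2) - f (k + 1))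
    (a : N → M)
    (heven : ∀ x y : M, |(load a x : ℤ) - (load a y : ℤ)| ≤ 1) :
    ∀ a' : N → M, totalCost f a ≤ totalCost f a' := by
  intro a'
  obtain ⟨x₀, hx₀⟩ := Finite.exists_min (load a)
  set q := load a x₀
  set g : ℕ → ℚ := fun k => (k : ℚ) * f k
  have htangent := add_increment_mul_le_of_monotone g
    (monotone_increment_natCast_mul f (fun k => (hf_mono k).le) hf_conv) q
  have heq : ∀ x, g (load a x) = g q + (g (q + 1) - g q) * ((load a x : ℚ) - q) := by
    intro x
    have hle := (abs_le.mp (heven x x₀)).2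
    have hge := hx₀ x
    obtain h | h : load a x = q ∨ load a x = q + 1 := by omega
    · simp [h]
    · rw [h]
      push_cast
      ring
  have hsum : ∑ x, (load a x : ℚ) = ∑ x, (load a' x : ℚ) := by
    exact_mod_cast (sum_load a).trans (sum_load a').symm
  rw [totalCost_eq_sum_load_mul, totalCost_eq_sum_load_mul]
  calc ∑ x, g (load a x)
      = ∑ x, (g q + (g (q + 1) - g q) * ((load a x : ℚ) - q)) :=
        Finset.sum_congr rfl fun x _ => heq x
    _ = ∑ x, (g q + (g (q + 1) - g q) * ((load a' x : ℚ) - q)) := by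
        simp only [Finset.sum_add_distrib, ← Finset.mul_sum, Finset.sum_sub_distrib, hsum]
    _ ≤ ∑ x, g (load a' x) := Finset.sum_le_sum fun x _ => htangent (load a' x)
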